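/- arXiv:1602.01506 — 7 statements merged into one kernel-verified Lean document; each statement's English description precedes it below -/
import Mathlib

section
/- Let f : [0,∞) → ℝ be a convex decreasing function having a root, let τ* denote its minimal root, fix a target accuracy ε > 0 and an oracle-accuracy constant α ∈ (1,2). Suppose initial points satisfy 0 ≤ τ₀ < τ₁ and f(τ₀) ≥ f(τ₁) > 0, and suppose real sequences (τ_k), (ℓ_k), (u_k), (s_k) are generated as follows: at each iteration k ≥ 1 with u_{k-1} > ε (and also at k = 0 for the initial evaluation), the oracle returns numbers ℓ_k, u_k with 0 < ℓ_k ≤ f(τ_k) ≤ u_k and u_k/ℓ_k ≤ α; then u_k is replaced by min{u_k, u_{k-1}}; the slope is set to s_k = (u_{k-1} − ℓ_k)/(τ_{k-1} − τ_k); and the next iterate is τ_{k+1} = τ_k − ℓ_k/s_k. Then the method terminates (i.e., reaches an iterate k with u_k ≤ ε) after at most max{2 + log_{2/α}(2C/ε), 3} iterations, where C := max{|s₁|(τ* − τ₁), ℓ₁} and s₁ := (u₀ − ℓ₁)/(τ₀ − τ₁). -/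
/-- The secant of a convex function through a point above its graph at `a` and a point below its
graph at `b > a` meets the axis no later than any root `r > b`. -/
lemma ConvexOn.mul_sub_le_of_root {f : ℝ → ℝ} {S : Set ℝ} (hf : ConvexOn ℝ S f)
    {a b r u l : ℝ} (ha : a ∈ S) (hr : r ∈ S) (hab : a < b) (hbr : b < r) (hroot : f r = 0)
    (hu : f a ≤ u) (hl : l ≤ f b) : l * (b - a) ≤ (u - l) * (r - b) := by
  have h := hf.slope_mono_adjacent ha hr hab hbr
  rw [hroot, div_le_div_iff₀ (sub_pos.2 hab) (sub_pos.2 hbr)] at h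
  nlinarith [mul_le_mul_of_nonneg_right hu (sub_pos.2 hbr).le,
    mul_le_mul_of_nonneg_right hl (sub_pos.2 hab).le,
    mul_le_mul_of_nonneg_right hl (sub_pos.2 hbr).le]

/-- One step of the inexact secant method: the slope is negative, its secant line minorizes `f`
at the root, the next iterate moves right, and the updated upper bound is valid and
`α`-accurate. -/
lemma inexact_secant_step {f : ℝ → ℝ} (hconv : ConvexOn ℝ (Set.Ici 0) f)
    (hdec : StrictAntiOn f (Set.Ici 0)) {r : ℝ} (hr : 0 ≤ r) (hroot : f r = 0)
    {α t₀ t₁ t₂ l u₀ u₁ s : ℝ} (ht₀ : 0 ≤ t₀) (ht : t₀ < t₁) (hu₀ : f t₀ ≤ u₀)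
    (hl : 0 < l) (hlf : l ≤ f t₁)
    (hu₁ : ∃ u' : ℝ, f t₁ ≤ u' ∧ u' / l ≤ α ∧ u₁ = min u' u₀)
    (hs : s = (u₀ - l) / (t₀ - t₁)) (ht₂ : t₂ = t₁ - l / s) :
    s < 0 ∧ l ≤ -s * (r - t₁) ∧ t₁ < t₂ ∧ f t₁ ≤ u₁ ∧ u₁ ≤ α * l := by
  have ht₁ : 0 ≤ t₁ := ht₀.trans ht.le
  have hlt : f t₁ < f t₀ := hdec ht₀ ht₁ ht
  have htr : t₁ < r := by
    rw [← hdec.lt_iff_gt hr ht₁, hroot]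
    exact hl.trans_le hlf
  have hs0 : s < 0 := by
    rw [hs]
    exact div_neg_of_pos_of_neg (by linarith) (by linarith)
  obtain ⟨u', hfu', hα, rfl⟩ := hu₁
  refine ⟨hs0, ?_, ?_, le_min hfu' (hlt.le.trans hu₀),
    (min_le_left _ _).trans ((div_le_iff₀ hl).1 hα)⟩
  · have hs' : -s = (u₀ - l) / (t₁ - t₀) := by
      rw [hs, ← neg_sub t₁ t₀, div_neg, neg_neg]
    rw [hs', div_mul_eq_mul_div, le_div_iff₀ (sub_pos.2 ht)]
    exact hconv.mul_sub_le_of_root (S := Set.Ici 0) ht₀ hr ht htr hroot hu₀ hlf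
  · have := div_neg_of_pos_of_neg hl hs0
    linarith

/-- Consecutive slope-times-bound products of the inexact secant method contract by `(α / 2) ^ 2`,
by the AM-GM inequality. -/
lemma inexact_secant_contraction {α l₁ l₂ u s₁ s₂ t₁ t₂ : ℝ} (hl₁ : 0 < l₁)
    (hs₁ : s₁ < 0) (hα : u ≤ α * l₁) (hl₂ : 0 < l₂)
    (ht₂ : t₂ = t₁ - l₁ / s₁) (hs₂ : s₂ = (u - l₂) / (t₁ - t₂)) :
    -s₂ * l₂ ≤ (α / 2) ^ 2 * (-s₁ * l₁) := by
  have h : s₂ = (u - l₂) * s₁ / l₁ := by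
    rw [hs₂, ht₂, sub_sub_cancel, div_div_eq_mul_div]
  have h' : -s₂ * l₂ = ((u - l₂) * l₂ / l₁) * (-s₁) := by rw [h]; ring
  rw [h', show (α / 2) ^ 2 * (-s₁ * l₁) = ((α / 2) ^ 2 * l₁) * (-s₁) by ring]
  refine mul_le_mul_of_nonneg_right ?_ (by linarith)
  rw [div_le_iff₀ hl₁]
  nlinarith [sq_nonneg (α * l₁ / 2 - l₂), mul_le_mul_of_nonneg_right hα hl₂.le]

/-- **Theorem 2.1 (Linear convergence of the inexact secant method).**
`f : [0,∞) → ℝ` is a decreasing convex function with minimal root `τstar`.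
Given a target accuracy `ε > 0`, oracle accuracy `α ∈ (1,2)`, initial points
`0 ≤ τ 0 < τ 1` with `f (τ 0) ≥ f (τ 1) > 0`, and sequences generated by the
inexact secant method (oracle evaluation, monotone upper bound update, secant
slope, secant step) as long as the previous upper bound exceeds `ε`, the method
terminates (reaches an iterate `k` with `u k ≤ ε`) after at most
`max (2 + log_{2/α} (2C/ε)) 3` iterations, where
`C = max (|s 1| * (τstar - τ 1)) (ℓ 1)` and `s 1 = (u 0 - ℓ 1)/(τ 0 - τ 1)`. -/
theorem inexact_secant_linear_convergence
    (f : ℝ → ℝ) (hconv : ConvexOn ℝ (Set.Ici 0) f)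
    (hdec : StrictAntiOn f (Set.Ici 0))
    (τstar : ℝ) (hτstar_nonneg : 0 ≤ τstar) (hτstar_root : f τstar = 0)
    (hτstar_min : ∀ t : ℝ, 0 ≤ t → f t = 0 → τstar ≤ t)
    (ε α : ℝ) (hε : 0 < ε) (hα1 : 1 < α) (hα2 : α < 2)
    (τ ell u s : ℕ → ℝ)
    (hτ0_nonneg : 0 ≤ τ 0) (hτ01 : τ 0 < τ 1)
    (hf01 : f (τ 1) ≤ f (τ 0)) (hf1_pos : 0 < f (τ 1))
    -- the initial oracle evaluation at τ 0
    (horacle0 : 0 < ell 0 ∧ ell 0 ≤ f (τ 0) ∧ f (τ 0) ≤ u 0 ∧ u 0 / ell 0 ≤ α)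
    -- at every iteration k ≥ 1 that is reached (previous upper bound above ε):
    -- oracle evaluation, upper bound monotonization, secant slope, secant step
    (hstep : ∀ k : ℕ, 1 ≤ k → ε < u (k - 1) →
      0 < ell k ∧ ell k ≤ f (τ k) ∧
      (∃ u' : ℝ, f (τ k) ≤ u' ∧ u' / ell k ≤ α ∧ u k = min u' (u (k - 1))) ∧
      s k = (u (k - 1) - ell k) / (τ (k - 1) - τ k) ∧
      τ (k + 1) = τ k - ell k / s k) :
    ∃ k : ℕ, u k ≤ ε ∧
      (k : ℝ) ≤
        max (2 + Real.logb (2 / α)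
              (2 * max (|s 1| * (τstar - τ 1)) (ell 1) / ε)) 3 := by
  have hstep' (m : ℕ) (hm : ε < u m) := hstep (m + 1) (Nat.le_add_left 1 m) hm
  simp only [Nat.add_sub_cancel] at hstep'
  have hsec (m : ℕ) (hm : ε < u m) (h0 : 0 ≤ τ m) (hlt : τ m < τ (m + 1))
      (hu : f (τ m) ≤ u m) :=
    inexact_secant_step hconv hdec hτstar_nonneg hτstar_root h0 hlt hu (hstep' m hm).1
      (hstep' m hm).2.1 (hstep' m hm).2.2.1 (hstep' m hm).2.2.2.1 (hstep' m hm).2.2.2.2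
  have hinv (m : ℕ) (hm : ∀ j ≤ m, ε < u j) :
      (0 ≤ τ m ∧ τ m < τ (m + 1) ∧ τ 1 ≤ τ (m + 1) ∧ f (τ m) ≤ u m) ∧
        -s (m + 1) * ell (m + 1) ≤ ((α / 2) ^ m) ^ 2 * (-s 1 * ell 1) := by
    induction m with
    | zero => exact ⟨⟨hτ0_nonneg, hτ01, le_rfl, horacle0.2.2.1⟩, by simp⟩
    | succ m ih =>
      obtain ⟨⟨h0, hlt, h1, hu⟩, hprod⟩ := ih fun j hj => hm j (by omega)
      have hum := hm m (by omega)
      obtain ⟨hs, -, hlt', hu', hα⟩ := hsec m hum h0 hlt hu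
      have hnext := hstep' (m + 1) (hm _ le_rfl)
      refine ⟨⟨h0.trans hlt.le, hlt', h1.trans hlt'.le, hu'⟩, ?_⟩
      calc -s (m + 1 + 1) * ell (m + 1 + 1)
          ≤ (α / 2) ^ 2 * (-s (m + 1) * ell (m + 1)) :=
            inexact_secant_contraction (hstep' m hum).1 hs hα hnext.1
              (hstep' m hum).2.2.2.2 hnext.2.2.2.1
        _ ≤ (α / 2) ^ 2 * (((α / 2) ^ m) ^ 2 * (-s 1 * ell 1)) := by gcongr
        _ = ((α / 2) ^ (m + 1)) ^ 2 * (-s 1 * ell 1) := by ring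
  set C := max (|s 1| * (τstar - τ 1)) (ell 1)
  have hlog (m : ℕ) (hm : ∀ j ≤ m + 1, ε < u j) :
      ((m + 1 : ℕ) : ℝ) ≤ Real.logb (2 / α) (2 * C / ε) := by
    obtain ⟨⟨h0, hlt, h1, hu⟩, hprod⟩ := hinv m fun j hj => hm j (by omega)
    have hum := hm m (by omega)
    have hu0 := hm 0 (by omega)
    obtain ⟨hs, hroot, -, -, hα⟩ := hsec m hum h0 hlt hu
    have hs1 : s 1 < 0 := (hsec 0 hu0 hτ0_nonneg hτ01 horacle0.2.2.1).1
    have hell : 0 < ell (m + 1) := (hstep' m hum).1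
    have hell1 : 0 < ell 1 := (hstep' 0 hu0).1
    have hC1 : -s 1 * (τstar - τ 1) ≤ C := abs_of_neg hs1 ▸ le_max_left _ _
    have hC2 : ell 1 ≤ C := le_max_right _ _
    have hC : 0 < C := hell1.trans_le hC2
    have hgap : 0 ≤ τstar - τ 1 := by
      have : 0 < τstar - τ (m + 1) :=
        pos_of_mul_pos_right (hell.trans_le hroot) (neg_pos.2 hs).le
      linarith
    have hsq : ell (m + 1) ^ 2 ≤ ((α / 2) ^ m * C) ^ 2 := by
      calc ell (m + 1) ^ 2
          = ell (m + 1) * ell (m + 1) := sq _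
        _ ≤ (-s (m + 1) * (τstar - τ 1)) * ell (m + 1) := by
            refine mul_le_mul_of_nonneg_right (hroot.trans ?_) hell.le
            exact mul_le_mul_of_nonneg_left (by linarith) (by linarith)
        _ = (-s (m + 1) * ell (m + 1)) * (τstar - τ 1) := by ring
        _ ≤ (((α / 2) ^ m) ^ 2 * (-s 1 * ell 1)) * (τstar - τ 1) := by gcongr
        _ = ((α / 2) ^ m) ^ 2 * ((-s 1 * (τstar - τ 1)) * ell 1) := by ring
        _ ≤ ((α / 2) ^ m) ^ 2 * (C * C) := by gcongr
        _ = ((α / 2) ^ m * C) ^ 2 := by ring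
    have hle : ell (m + 1) ≤ (α / 2) ^ m * C := by
      exact (sq_le_sq₀ hell.le (by positivity)).1 hsq
    have hε' : ε ≤ (α / 2) ^ (m + 1) * (2 * C) := by
      calc ε ≤ u (m + 1) := (hm _ le_rfl).le
        _ ≤ α * ell (m + 1) := hα
        _ ≤ α * ((α / 2) ^ m * C) := by gcongr
        _ = (α / 2) ^ (m + 1) * (2 * C) := by ring
    have hbase : 1 < 2 / α := (one_lt_div (by linarith)).2 hα2
    rw [Real.le_logb_iff_rpow_le hbase (by positivity), Real.rpow_natCast, le_div_iff₀ hε]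
    calc (2 / α) ^ (m + 1) * ε
        ≤ (2 / α) ^ (m + 1) * ((α / 2) ^ (m + 1) * (2 * C)) := by gcongr
      _ = (2 / α * (α / 2)) ^ (m + 1) * (2 * C) := by rw [mul_pow, mul_assoc]
      _ = 2 * C := by
        rw [div_mul_div_cancel₀ (by linarith), div_self two_ne_zero, one_pow, one_mul]
  by_contra! hcon
  set B := max (2 + Real.logb (2 / α) (2 * C / ε)) 3
  have hB3 : (3 : ℝ) ≤ B := le_max_right _ _
  have hB : 2 + Real.logb (2 / α) (2 * C / ε) ≤ B := le_max_left _ _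
  have hpos : 1 ≤ ⌊B⌋₊ := Nat.le_floor (by push_cast; linarith)
  have hall (j : ℕ) (hj : j ≤ ⌊B⌋₊) : ε < u j := by
    by_contra! hle
    exact (hcon j hle).not_ge ((Nat.le_floor_iff (by linarith)).1 hj)
  obtain ⟨m, hm⟩ := Nat.exists_eq_add_of_le' hpos
  have hlog_floor := hlog m (hm ▸ hall)
  rw [← hm] at hlog_floor
  linarith [Nat.lt_floor_add_one B]
end

section
/- Let f : [0,∞) → ℝ be a convex decreasing function having a root, let τ* denote its minimal root, fix a target accuracy ε > 0 and an oracle-accuracy constant α ∈ (1,2). Suppose τ₀ satisfies f(τ₀) > 0, set u_{-1} = +∞, and suppose real sequences (τ_k), (ℓ_k), (u_k), (s_k) are generated as follows: at each iteration k ≥ 0 with u_{k-1} > ε, the affine minorant oracle returns (ℓ_k, u_k, s_k) with 0 < ℓ_k ≤ f(τ_k) ≤ u_k, u_k/ℓ_k ≤ α, and such that the affine function τ ↦ ℓ_k + s_k(τ − τ_k) globally minorizes f; then u_k is replaced by min{u_k, u_{k-1}}; and the next iterate is τ_{k+1} = τ_k − ℓ_k/s_k. Then the method terminates (i.e., reaches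 an iterate k with u_k ≤ ε) after at most max{1 + log_{2/α}(2C/ε), 2} iterations, where C := max{|s₀|(τ* − τ₀), ℓ₀}. -/
/-- If an affine function through `(x, a)` with slope `σ` lies below a value `v ≤ α * b` at the
point `y`, where `x = y - b / r` is a Newton step from `y`, then `a * |σ|` contracts. -/
lemma newton_step_contraction {a b r σ x y v α : ℝ} (ha : 0 < a) (hb : 0 < b) (hr : r < 0)
    (hσ : σ < 0) (hx : x = y - b / r) (hmin : a + σ * (y - x) ≤ v) (hv : v ≤ α * b) :
    a * -σ ≤ (α / 2) ^ 2 * (b * -r) := by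
  have hne : r ≠ 0 := hr.ne
  have hstep : y - x = b / r := by rw [hx]; ring
  rw [hstep] at hmin
  have hsum : a * -r + b * -σ ≤ α * (b * -r) := by
    have h := mul_le_mul_of_nonneg_right (hmin.trans hv) (neg_pos.2 hr).le
    have e : (a + σ * (b / r)) * -r = a * -r + b * -σ := by field_simp; ring
    rw [e] at h
    linarith
  have hbr : 0 < b * -r := mul_pos hb (neg_pos.2 hr)
  have hpos : 0 < a * -r + b * -σ :=
    add_pos (mul_pos ha (neg_pos.2 hr)) (mul_pos hb (neg_pos.2 hσ))
  have hsq : (a * -r + b * -σ) ^ 2 ≤ (α * (b * -r)) ^ 2 := pow_le_pow_left₀ hpos.le hsum 2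
  refine le_of_mul_le_mul_right ?_ hbr
  nlinarith [sq_nonneg (a * -r - b * -σ)]

/-- The geometric bound `c * q⁻¹ ^ n ≤ ε` holds once `n` is at least `logb q (c / ε)`. -/
lemma mul_inv_pow_le_of_logb_le {q c ε : ℝ} (hq : 1 < q) (hc : 0 < c) (hε : 0 < ε) {n : ℕ}
    (hn : Real.logb q (c / ε) ≤ n) : c * q⁻¹ ^ n ≤ ε := by
  have h := (Real.logb_le_iff_le_rpow hq (div_pos hc hε)).1 hn
  rw [Real.rpow_natCast, div_le_iff₀ hε] at h
  rw [inv_pow, ← div_eq_mul_inv, div_le_iff₀ (by positivity)]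
  linarith

/-- **Theorem 2.2 (Linear convergence of the inexact Newton method).**
`f : [0,∞) → ℝ` is a decreasing convex function with minimal root `τstar`.
Given target accuracy `ε > 0`, oracle accuracy `α ∈ (1,2)`, an initial point
`τ 0 ≥ 0` with `f (τ 0) > 0`, and sequences generated by the inexact Newton
method based on an affine minorant oracle (with `u (-1) = +∞`, so the first
iteration always happens and performs no upper-bound monotonization), the
method terminates (reaches `k` with `u k ≤ ε`) after at most
`max (1 + log_{2/α} (2C/ε)) 2` iterations, where
`C = max (|s 0| * (τstar - τ 0)) (ℓ 0)`. -/
theorem inexact_newton_linear_convergence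
    (f : ℝ → ℝ) (hconv : ConvexOn ℝ (Set.Ici 0) f)
    (hdec : StrictAntiOn f (Set.Ici 0))
    (τstar : ℝ) (hτstar_nonneg : 0 ≤ τstar) (hτstar_root : f τstar = 0)
    (hτstar_min : ∀ t : ℝ, 0 ≤ t → f t = 0 → τstar ≤ t)
    (ε α : ℝ) (hε : 0 < ε) (hα1 : 1 < α) (hα2 : α < 2)
    (τ ell u s : ℕ → ℝ)
    (hτ0_nonneg : 0 ≤ τ 0) (hf0_pos : 0 < f (τ 0))
    -- iteration k = 0 (u_{-1} = +∞: no guard, no min-update)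
    (horacle0 : 0 < ell 0 ∧ ell 0 ≤ f (τ 0) ∧ f (τ 0) ≤ u 0 ∧ u 0 / ell 0 ≤ α ∧
      (∀ t : ℝ, 0 ≤ t → ell 0 + s 0 * (t - τ 0) ≤ f t) ∧
      τ 1 = τ 0 - ell 0 / s 0)
    -- at every iteration k ≥ 1 that is reached (previous upper bound above ε):
    -- affine minorant oracle, upper bound monotonization, Newton step
    (hstep : ∀ k : ℕ, 1 ≤ k → ε < u (k - 1) →
      0 < ell k ∧ ell k ≤ f (τ k) ∧
      (∃ u' : ℝ, f (τ k) ≤ u' ∧ u' / ell k ≤ α ∧ u k = min u' (u (k - 1))) ∧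
      (∀ t : ℝ, 0 ≤ t → ell k + s k * (t - τ k) ≤ f t) ∧
      τ (k + 1) = τ k - ell k / s k) :
    ∃ k : ℕ, u k ≤ ε ∧
      (k : ℝ) ≤
        max (1 + Real.logb (2 / α)
              (2 * max (|s 0| * (τstar - τ 0)) (ell 0) / ε)) 2 := by
  have hτ0 : τ 0 < τstar := by
    by_contra! h
    have := hdec.antitoneOn hτstar_nonneg hτ0_nonneg h
    linarith
  obtain ⟨hell0, -, hfu0, hu0, hmin0, hτ1⟩ := horacle0
  have slope_neg : ∀ k, 0 < ell k → τ k < τstar →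
      (∀ t : ℝ, 0 ≤ t → ell k + s k * (t - τ k) ≤ f t) → s k < 0 := by
    intro k hl ht hm
    have h := hm τstar hτstar_nonneg
    by_contra! hs
    nlinarith [mul_nonneg hs (sub_pos.2 ht).le]
  have hs0 := slope_neg 0 hell0 hτ0 hmin0
  have invariant : ∀ k, (∀ j < k, ε < u j) →
      0 < ell k ∧ s k < 0 ∧ τ 0 ≤ τ k ∧ τ k < τstar ∧ f (τ k) ≤ α * ell k ∧ u k ≤ α * ell k ∧
      (∀ t : ℝ, 0 ≤ t → ell k + s k * (t - τ k) ≤ f t) ∧ τ (k + 1) = τ k - ell k / s k ∧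
      ell k * -s k ≤ ((α / 2) ^ k) ^ 2 * (ell 0 * -s 0) := by
    intro k
    induction k with
    | zero =>
      intro _
      have := (div_le_iff₀ hell0).1 hu0
      exact ⟨hell0, hs0, le_rfl, hτ0, hfu0.trans this, this, hmin0, hτ1, by simp⟩
    | succ k ih =>
      intro hall
      obtain ⟨hl, hs, hτ, hτs, hf, -, hm, hnext, hprod⟩ :=
        ih fun j hj => hall j (hj.trans k.lt_succ_self)
      obtain ⟨hl', hlf, ⟨u', hfu', hu', huk⟩, hm', hnext'⟩ :=
        hstep (k + 1) (Nat.le_add_left 1 k) (hall k k.lt_succ_self)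
      have hle : τ 0 ≤ τ (k + 1) := by
        rw [hnext]
        linarith [div_neg_of_pos_of_neg hl hs]
      have hlt : τ (k + 1) < τstar := by
        by_contra! h
        have := hdec.antitoneOn hτstar_nonneg (hτ0_nonneg.trans hle) h
        linarith
      have hs' := slope_neg (k + 1) hl' hlt hm'
      have hα' := (div_le_iff₀ hl').1 hu'
      have hcontr := newton_step_contraction hl' hl hs hs' hnext
        (hm' (τ k) (hτ0_nonneg.trans hτ)) hf
      refine ⟨hl', hs', hle, hlt, hfu'.trans hα', ?_, hm', hnext', ?_⟩
      · rw [huk]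
        exact (min_le_left _ _).trans hα'
      · calc ell (k + 1) * -s (k + 1) ≤ (α / 2) ^ 2 * (ell k * -s k) := hcontr
          _ ≤ (α / 2) ^ 2 * (((α / 2) ^ k) ^ 2 * (ell 0 * -s 0)) := by gcongr
          _ = ((α / 2) ^ (k + 1)) ^ 2 * (ell 0 * -s 0) := by ring
  set C := max (|s 0| * (τstar - τ 0)) (ell 0) with hC
  have hCs : -s 0 * (τstar - τ 0) ≤ C := by
    rw [hC, abs_of_neg hs0]
    exact le_max_left _ _
  have hCl : ell 0 ≤ C := le_max_right _ _
  have hC0 : 0 < C := hell0.trans_le hCl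
  have bound : ∀ k, (∀ j < k, ε < u j) → u k ≤ 2 * C * (2 / α)⁻¹ ^ k := by
    intro k hall
    obtain ⟨hl, hs, hτ, hτs, -, hu, hm, -, hprod⟩ := invariant k hall
    have hell : ell k ≤ -s k * (τstar - τ 0) := by
      have h := hm τstar hτstar_nonneg
      nlinarith [mul_nonneg (neg_pos.2 hs).le (sub_nonneg.2 hτ)]
    have hgap : 0 < τstar - τ 0 := sub_pos.2 hτ0
    have hsq : ell k ^ 2 ≤ (C * (α / 2) ^ k) ^ 2 := by
      calc ell k ^ 2 = ell k * ell k := sq _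
        _ ≤ ell k * (-s k * (τstar - τ 0)) := by gcongr
        _ = ell k * -s k * (τstar - τ 0) := by ring
        _ ≤ ((α / 2) ^ k) ^ 2 * (ell 0 * -s 0) * (τstar - τ 0) := by gcongr
        _ = ((α / 2) ^ k) ^ 2 * (ell 0 * (-s 0 * (τstar - τ 0))) := by ring
        _ ≤ ((α / 2) ^ k) ^ 2 * (C * C) := by
          gcongr
          exact (mul_pos (neg_pos.2 hs0) hgap).le
        _ = (C * (α / 2) ^ k) ^ 2 := by ring
    have hlC : ell k ≤ C * (α / 2) ^ k := (sq_le_sq₀ hl.le (by positivity)).1 hsq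
    calc u k ≤ α * ell k := hu
      _ ≤ 2 * (C * (α / 2) ^ k) := by gcongr
      _ = 2 * C * (2 / α)⁻¹ ^ k := by rw [inv_div]; ring
  have hq : 1 < 2 / α := (one_lt_div (by linarith)).2 hα2
  set L := Real.logb (2 / α) (2 * C / ε)
  have hN : ∃ k ≤ ⌈L⌉₊, u k ≤ ε := by
    by_contra! hall
    refine (hall _ le_rfl).not_ge ((bound _ fun j hj => hall j hj.le).trans ?_)
    exact mul_inv_pow_le_of_logb_le hq (by positivity) hε (Nat.le_ceil L)
  obtain ⟨k, hk, huk⟩ := hN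
  refine ⟨k, huk, ?_⟩
  have hk' : (k : ℝ) ≤ ⌈L⌉₊ := by exact_mod_cast hk
  refine hk'.trans ?_
  rcases le_total L 0 with h | h
  · simp [Nat.ceil_eq_zero.2 h]
  · exact le_max_of_le_left (by linarith [Nat.ceil_lt_add_one h])
end

section
/- Let f : [0,∞) → ℝ and let τ_{k-1} < τ_k be points with f(τ_k) > 0. Suppose (ℓ_{k-1}, u_{k-1}, s_{k-1}) and (ℓ_k, u_k, s_k) are outputs of an affine minorant oracle for f at τ_{k-1} and τ_k respectively; in particular u_{k-1} ≥ f(τ_{k-1}), 0 < ℓ_k, and ℓ_k + s_k(τ' − τ_k) ≤ f(τ') for all τ'. Then the secant slope s_k^{sec} := (u_{k-1} − ℓ_k)/(τ_{k-1} − τ_k) satisfies s_k^{sec} ≤ s_k, and consequently (when both slopes are negative) the Newton step length −ℓ_k/s_k is at least as large as the secant step length −ℓ_k/s_k^{sec}. -/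
/-- **Newton steps are never shorter than secant steps.**
If `(ℓ_{k-1}, u_{k-1}, s_{k-1})` and `(ℓ_k, u_k, s_k)` are outputs of an affine
minorant oracle for `f` at points `τ_{k-1} < τ_k` with `f τ_k > 0`, then the
secant slope `(u_{k-1} − ℓ_k)/(τ_{k-1} − τ_k)` is at most the Newton slope
`s_k`; consequently, when both slopes are negative, the Newton step length
`−ℓ_k/s_k` is at least as large as the secant step length. -/
theorem newton_step_at_least_secant_step
    (f : ℝ → ℝ) (τkm1 τk : ℝ) (hτ : τkm1 < τk) (hfτk : 0 < f τk)
    (ellkm1 ukm1 skm1 ellk uk sk : ℝ)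
    (horacle_km1 : 0 < ellkm1 ∧ ellkm1 ≤ f τkm1 ∧ f τkm1 ≤ ukm1 ∧
      ∀ t : ℝ, ellkm1 + skm1 * (t - τkm1) ≤ f t)
    (horacle_k : 0 < ellk ∧ ellk ≤ f τk ∧ f τk ≤ uk ∧
      ∀ t : ℝ, ellk + sk * (t - τk) ≤ f t) :
    (ukm1 - ellk) / (τkm1 - τk) ≤ sk ∧
    ((ukm1 - ellk) / (τkm1 - τk) < 0 → sk < 0 →
      -ellk / ((ukm1 - ellk) / (τkm1 - τk)) ≤ -ellk / sk) := by
  obtain ⟨hell, -, -, hminor⟩ := horacle_k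
  have hslope : (ukm1 - ellk) / (τkm1 - τk) ≤ sk := by
    rw [div_le_iff_of_neg (sub_neg.mpr hτ)]
    linarith [hminor τkm1, horacle_km1.2.2.1]
  refine ⟨hslope, fun hsec hsk => ?_⟩
  rw [div_eq_mul_inv (-ellk), div_eq_mul_inv (-ellk)]
  exact mul_le_mul_of_nonpos_left ((inv_le_inv_of_neg hsk hsec).mpr hslope)
    (neg_nonpos.mpr hell.le)
end

section
/- Let f : ℝ → ℝ be a nonincreasing convex function on an interval [a,b]. Suppose the point τ* := inf{τ : f(τ) ≤ 0} lies in (a,b) and the nondegeneracy condition g* := inf{g : g ∈ ∂f(τ*)} < 0 holds. Fix τ₁ ∈ (a,b) with τ₁ < τ* and consider the Newton iteration: τ_{k+1} = τ_k if f(τ_k) = 0, and otherwise τ_{k+1} = τ_k − f(τ_k)/g_k for some chosen g_k ∈ ∂f(τ_k). If the sequence terminates finitely at some τ_k (i.e., f(τ_k) = 0) then τ_k = τ*. If it does not terminate finitely, then the iterates are strictly increasing with τ_k < τ*, for every k ≥ 1 one has |τ* − τ_{k+1}| ≤ (1 − g*/g_k)|τ* − τ_k|, the subgradients satisfy g_k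 → g* monotonically from below, and τ_k increases to τ* q-superlinearly (i.e., |τ* − τ_{k+1}|/|τ* − τ_k| → 0). -/
open Filter Topology Set

/-- The greatest lower bound of the relative subdifferential at a point is itself a subgradient. -/
theorem isGLB_subgradients_mem {f : ℝ → ℝ} {s : Set ℝ} {x m : ℝ}
    (h : IsGLB {g : ℝ | ∀ y ∈ s, f x + g * (y - x) ≤ f y} m) :
    ∀ y ∈ s, f x + m * (y - x) ≤ f y := by
  have hclosed : IsClosed {g : ℝ | ∀ y ∈ s, f x + g * (y - x) ≤ f y} := by
    simp only [ofPred_forall]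
    exact isClosed_biInter fun y _ => isClosed_le (by fun_prop) continuous_const
  exact hclosed.closure_subset (h.mem_closure h.nonempty)

/-- Subgradients are monotone in the base point. -/
theorem subgradient_le_of_lt {f : ℝ → ℝ} {x y g h : ℝ} (hxy : x < y)
    (hg : f x + g * (y - x) ≤ f y) (hh : f y + h * (x - y) ≤ f x) : g ≤ h := by
  by_contra! hlt
  nlinarith [mul_pos (sub_pos.2 hlt) (sub_pos.2 hxy)]

/-- A nonincreasing convex function on an interval vanishes at an interior point that is the
infimum of its zero sublevel set. -/
theorem eq_zero_of_isGLB_sublevel {f : ℝ → ℝ} {a b t : ℝ}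
    (hconv : ConvexOn ℝ (Icc a b) f) (hdec : AntitoneOn f (Icc a b)) (ht : t ∈ Ioo a b)
    (hinf : IsGLB {x | x ∈ Icc a b ∧ f x ≤ 0} t) : f t = 0 := by
  have hcont : ContinuousAt f t := by
    have h := hconv.continuousOn_interior
    rw [interior_Icc] at h
    exact h.continuousAt (Ioo_mem_nhds ht.1 ht.2)
  apply le_antisymm
  · refine le_of_tendsto (hcont.tendsto.mono_left (nhdsWithin_le_nhds (s := Ioi t))) ?_
    filter_upwards [Ioo_mem_nhdsGT ht.2] with x hx
    obtain ⟨y, ⟨hy, hfy⟩, hyx⟩ := (isGLB_lt_iff hinf).1 hx.1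
    exact (hdec hy ⟨(ht.1.trans hx.1).le, hx.2.le⟩ hyx.le).trans hfy
  · refine ge_of_tendsto (hcont.tendsto.mono_left (nhdsWithin_le_nhds (s := Iio t))) ?_
    filter_upwards [Ioo_mem_nhdsLT ht.1] with x hx
    by_contra! hneg
    exact hx.2.not_ge (hinf.1 ⟨⟨hx.1.le, (hx.2.trans ht.2).le⟩, hneg.le⟩)

/-- **Superlinear convergence of the Newton method (Theorem A.1, Newton part).**
Let `f` be a nonincreasing convex function on `[a,b]`, let
`τstar = inf {τ ∈ [a,b] : f τ ≤ 0}` lie in `(a,b)`, and suppose the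
nondegeneracy condition `gstar = inf ∂f(τstar) < 0` holds, where the
subdifferential is taken relative to `[a,b]`. Starting from `τ 1 ∈ (a,b)`
with `τ 1 < τstar`, the Newton iteration (with chosen subgradients
`g k ∈ ∂f(τ k)`) either terminates finitely exactly at `τstar`, or else the
iterates strictly increase while remaining below `τstar`, satisfy
`|τstar − τ (k+1)| ≤ (1 − gstar/g k)·|τstar − τ k|`, the subgradients increase
to `gstar` from below, and `τ k ↑ τstar` globally q-superlinearly. -/
theorem newton_superlinear
    (f : ℝ → ℝ) (a b : ℝ) (hab : a < b)
    (hconv : ConvexOn ℝ (Set.Icc a b) f)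
    (hdec : AntitoneOn f (Set.Icc a b))
    (subdiff : ℝ → Set ℝ)
    (hsubdiff : ∀ t : ℝ,
      subdiff t = {g : ℝ | ∀ t' ∈ Set.Icc a b, f t + g * (t' - t) ≤ f t'})
    (τstar : ℝ) (hτstar_mem : τstar ∈ Set.Ioo a b)
    (hτstar_inf : IsGLB {t | t ∈ Set.Icc a b ∧ f t ≤ 0} τstar)
    (gstar : ℝ) (hgstar_inf : IsGLB (subdiff τstar) gstar) (hgstar_neg : gstar < 0)
    (τ g : ℕ → ℝ)
    (hτ1_mem : τ 1 ∈ Set.Ioo a b) (hτ1_lt : τ 1 < τstar)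
    (hg : ∀ k : ℕ, 1 ≤ k → g k ∈ subdiff (τ k))
    (hiter : ∀ k : ℕ, 1 ≤ k →
      (f (τ k) = 0 → τ (k + 1) = τ k) ∧
      (f (τ k) ≠ 0 → τ (k + 1) = τ k - f (τ k) / g k)) :
    (∀ k : ℕ, 1 ≤ k → f (τ k) = 0 → τ k = τstar) ∧
    ((∀ k : ℕ, 1 ≤ k → f (τ k) ≠ 0) →
      (∀ k : ℕ, 1 ≤ k → τ k < τ (k + 1)) ∧
      (∀ k : ℕ, 1 ≤ k → τ k < τstar) ∧
      (∀ k : ℕ, 1 ≤ k →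
        |τstar - τ (k + 1)| ≤ (1 - gstar / g k) * |τstar - τ k|) ∧
      (∀ k : ℕ, 1 ≤ k → g k ≤ g (k + 1)) ∧
      (∀ k : ℕ, 1 ≤ k → g k ≤ gstar) ∧
      Filter.Tendsto g Filter.atTop (nhds gstar) ∧
      Filter.Tendsto τ Filter.atTop (nhds τstar) ∧
      Filter.Tendsto (fun k : ℕ => |τstar - τ (k + 1)| / |τstar - τ k|)
        Filter.atTop (nhds 0)) := by
  obtain rfl : subdiff = fun t => {g : ℝ | ∀ t' ∈ Icc a b, f t + g * (t' - t) ≤ f t'} :=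
    funext hsubdiff
  have hzero : f τstar = 0 := eq_zero_of_isGLB_sublevel hconv hdec hτstar_mem hτstar_inf
  have hgs := isGLB_subgradients_mem hgstar_inf
  have hsI : τstar ∈ Icc a b := Ioo_subset_Icc_self hτstar_mem
  have hI : ∀ t, a < t → t ≤ τstar → t ∈ Icc a b := fun t h1 h2 =>
    ⟨h1.le, h2.trans hsI.2⟩
  have hpos : ∀ t, a < t → t < τstar → 0 < f t := by
    intro t h1 h2
    by_contra! h
    exact h2.not_ge (hτstar_inf.1 ⟨hI t h1 h2.le, h⟩)
  have hgle : ∀ k, 1 ≤ k → a < τ k → τ k < τstar → g k ≤ gstar := fun k hk h1 h2 =>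
    subgradient_le_of_lt h2 (hg k hk _ hsI) (hgs _ (hI _ h1 h2.le))
  have hinv : ∀ k, 1 ≤ k → a < τ k ∧ τ k ≤ τstar := by
    intro k hk
    induction k, hk using Nat.le_induction with
    | base => exact ⟨hτ1_mem.1, hτ1_lt.le⟩
    | succ k hk ih =>
      obtain ⟨h1, h2⟩ := ih
      by_cases hf : f (τ k) = 0
      · rw [(hiter k hk).1 hf]
        exact ⟨h1, h2⟩
      · have hlt : τ k < τstar := h2.lt_of_ne fun h => hf (h ▸ hzero)
        have hneg := (hgle k hk h1 hlt).trans_lt hgstar_neg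
        have hdiv := div_neg_of_pos_of_neg (hpos _ h1 hlt) hneg
        have hsub := hg k hk _ hsI
        rw [(hiter k hk).2 hf]
        refine ⟨by linarith, ?_⟩
        have : τ k - τstar ≤ f (τ k) / g k := by
          rw [le_div_iff_of_neg hneg]
          linarith
        linarith
  refine ⟨fun k hk hf => (hinv k hk).2.antisymm
    (hτstar_inf.1 ⟨hI _ (hinv k hk).1 (hinv k hk).2, hf.le⟩), fun hne => ?_⟩
  have hlt : ∀ k, 1 ≤ k → τ k < τstar := fun k hk =>
    (hinv k hk).2.lt_of_ne fun h => hne k hk (h ▸ hzero)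
  have hle : ∀ k, 1 ≤ k → g k ≤ gstar := fun k hk => hgle k hk (hinv k hk).1 (hlt k hk)
  have hneg : ∀ k, 1 ≤ k → g k < 0 := fun k hk => (hle k hk).trans_lt hgstar_neg
  have hstep : ∀ k, 1 ≤ k → τ (k + 1) = τ k - f (τ k) / g k := fun k hk =>
    (hiter k hk).2 (hne k hk)
  have hmono : ∀ k, 1 ≤ k → τ k < τ (k + 1) := by
    intro k hk
    have := div_neg_of_pos_of_neg (hpos _ (hinv k hk).1 (hlt k hk)) (hneg k hk)
    rw [hstep k hk]
    linarith
  have hmem : ∀ k, 1 ≤ k → τ k ∈ Icc a b := fun k hk =>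
    hI _ (hinv k hk).1 (hinv k hk).2
  have hlower : ∀ k, 1 ≤ k → gstar * (τ k - τstar) ≤ f (τ k) := fun k hk => by
    simpa [hzero] using hgs _ (hmem k hk)
  have hcontr : ∀ k, 1 ≤ k →
      |τstar - τ (k + 1)| ≤ (1 - gstar / g k) * |τstar - τ k| := by
    intro k hk
    rw [abs_of_pos (sub_pos.2 (hlt _ (by omega))), abs_of_pos (sub_pos.2 (hlt k hk)),
      hstep k hk]
    have h := div_le_div_of_nonpos_of_le (hneg k hk).le (hlower k hk)
    have e : gstar * (τ k - τstar) / g k = -(gstar / g k * (τstar - τ k)) := by ring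
    linarith
  have hgmono : ∀ k, 1 ≤ k → g k ≤ g (k + 1) := fun k hk =>
    subgradient_le_of_lt (hmono k hk) (hg k hk _ (hmem _ (by omega)))
      (hg (k + 1) (by omega) _ (hmem k hk))
  have hτtail : Tendsto (fun k => τ (k + 1)) atTop (𝓝 (⨆ k, τ (k + 1))) :=
    tendsto_atTop_ciSup (monotone_nat_of_le_succ fun k => (hmono (k + 1) (by omega)).le)
      ⟨τstar, by rintro _ ⟨k, rfl⟩; exact (hlt (k + 1) (by omega)).le⟩
  have hgtail : Tendsto (fun k => g (k + 1)) atTop (𝓝 (⨆ k, g (k + 1))) :=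
    tendsto_atTop_ciSup (monotone_nat_of_le_succ fun k => hgmono (k + 1) (by omega))
      ⟨gstar, by rintro _ ⟨k, rfl⟩; exact hle (k + 1) (by omega)⟩
  have hτlim := (tendsto_add_atTop_iff_nat 1).1 hτtail
  have hglim := (tendsto_add_atTop_iff_nat 1).1 hgtail
  generalize (⨆ k, τ (k + 1)) = L at hτlim hτtail
  generalize (⨆ k, g (k + 1)) = G at hglim
  have hflim : Tendsto (fun k => f (τ k)) atTop (𝓝 0) := by
    have h : Tendsto (fun k => g k * (τ k - τ (k + 1))) atTop (𝓝 0) := by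
      simpa using hglim.mul (hτlim.sub hτtail)
    refine h.congr' ?_
    filter_upwards [eventually_ge_atTop 1] with k hk
    rw [hstep k hk, sub_sub_cancel, mul_div_cancel₀ _ (hneg k hk).ne]
  have hL : L = τstar := by
    apply le_antisymm
    · refine le_of_tendsto hτlim ?_
      filter_upwards [eventually_ge_atTop 1] with k hk using (hlt k hk).le
    · have h : gstar * (L - τstar) ≤ 0 := by
        refine le_of_tendsto_of_tendsto ((hτlim.sub_const τstar).const_mul gstar) hflim ?_
        filter_upwards [eventually_ge_atTop 1] with k hk using hlower k hk
      exact sub_nonneg.1 (nonneg_of_mul_nonpos_right h hgstar_neg)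
  subst hL
  have hG : G = gstar := by
    apply le_antisymm
    · refine le_of_tendsto hglim ?_
      filter_upwards [eventually_ge_atTop 1] with k hk using hle k hk
    · refine hgstar_inf.1 fun t ht => ?_
      rw [hzero]
      refine le_of_tendsto (hflim.add (hglim.mul (hτlim.const_sub t))) ?_
      filter_upwards [eventually_ge_atTop 1] with k hk using hg k hk t ht
  subst hG
  refine ⟨hmono, hlt, hcontr, hgmono, hle, hglim, hτlim, ?_⟩
  have hbound : Tendsto (fun k => 1 - G / g k) atTop (𝓝 0) := by
    simpa [div_self hgstar_neg.ne] using
      ((tendsto_const_nhds (x := G)).div hglim hgstar_neg.ne).const_sub 1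
  refine squeeze_zero' (Eventually.of_forall fun k => by positivity) ?_ hbound
  filter_upwards [eventually_ge_atTop 1] with k hk
  rw [div_le_iff₀ (abs_pos.2 (sub_pos.2 (hlt k hk)).ne')]
  exact hcontr k hk
end

section
/- Let K ⊆ ℝⁿ be a proper cone (closed, convex, pointed, with nonempty interior), fix e ∈ int K, and define λ_min(x) := inf{λ ∈ ℝ : x − λe ∉ K} (equivalently, sup{λ : x − λe ∈ K}), a finite-valued concave function. Then the Fenchel conjugate of −λ_min satisfies (−λ_min)*(y) = δ_S(−y) for all y ∈ ℝⁿ, where S = K* ∩ {x : ⟨e, x⟩ = 1}; that is, sup_{x∈ℝⁿ}(⟨x, y⟩ + λ_min(x)) equals 0 if −y ∈ K* and ⟨e, −y⟩ = 1, and equals +∞ otherwise. -/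
open scoped RealInnerProductSpace

/-- The supremum of a real-valued family that dominates every real is `⊤` in `EReal`. -/
theorem EReal.iSup_coe_eq_top_of_forall_exists_le {ι : Sort*} {f : ι → ℝ}
    (h : ∀ M : ℝ, ∃ i, M ≤ f i) : (⨆ i, (f i : EReal)) = ⊤ := by
  rw [EReal.eq_top_iff_forall_lt]
  intro M
  obtain ⟨i, hi⟩ := h (M + 1)
  refine lt_of_lt_of_le ?_ (le_iSup (fun i => (f i : EReal)) i)
  exact_mod_cast (lt_add_one M).trans_le hi

/-- **Lemma A.3 (conjugate of −λ_min).**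
Let `K ⊆ ℝⁿ` be a proper cone (closed, convex, pointed, with nonempty
interior), fix `e ∈ int K`, and let `λ_min x = sup {λ : x − λe ∈ K}`
(a finite-valued function, encoded via `IsLUB`). Then
`(−λ_min)*(y) = δ_S(−y)` where `S = K* ∩ {x : ⟪e,x⟫ = 1}`; that is,
`sup_x (⟪x,y⟫ + λ_min x)` equals `0` if `−y ∈ K*` and `⟪e,−y⟫ = 1`,
and equals `+∞` otherwise. -/
theorem conjugate_of_neg_lambdaMin
    (n : ℕ) (K : Set (EuclideanSpace ℝ (Fin n)))
    (hK_closed : IsClosed K) (hK_convex : Convex ℝ K)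
    (hK_cone : ∀ (c : ℝ), 0 ≤ c → ∀ x ∈ K, c • x ∈ K)
    (hK_pointed : ∀ x ∈ K, -x ∈ K → x = 0)
    (e : EuclideanSpace ℝ (Fin n)) (he : e ∈ interior K)
    (lammin : EuclideanSpace ℝ (Fin n) → ℝ)
    (hlammin : ∀ x, IsLUB {lam : ℝ | x - lam • e ∈ K} (lammin x)) :
    ∀ y : EuclideanSpace ℝ (Fin n),
      ((-y ∈ {w : EuclideanSpace ℝ (Fin n) | ∀ x ∈ K, 0 ≤ ⟪x, w⟫} ∧ ⟪e, -y⟫ = (1 : ℝ)) →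
        (⨆ x : EuclideanSpace ℝ (Fin n), ((⟪x, y⟫ + lammin x : ℝ) : EReal)) = 0) ∧
      (¬(-y ∈ {w : EuclideanSpace ℝ (Fin n) | ∀ x ∈ K, 0 ≤ ⟪x, w⟫} ∧ ⟪e, -y⟫ = (1 : ℝ)) →
        (⨆ x : EuclideanSpace ℝ (Fin n), ((⟪x, y⟫ + lammin x : ℝ) : EReal)) = ⊤) := by
  have h_zero : (0 : EuclideanSpace ℝ (Fin n)) ∈ K := by
    simpa using hK_cone 0 le_rfl e (interior_subset he)
  have h_nonneg : ∀ x ∈ K, 0 ≤ lammin x := fun x hx => (hlammin x).1 (by simpa using hx)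
  intro y
  refine ⟨fun ⟨hy, hey⟩ => le_antisymm (iSup_le fun x => ?_) ?_, fun h => ?_⟩
  · have hx : lammin x ≤ ⟪x, -y⟫ := by
      refine (hlammin x).2 fun lam hlam => ?_
      have := hy _ hlam
      rw [inner_sub_left, real_inner_smul_left, hey] at this
      linarith
    rw [inner_neg_right] at hx
    exact_mod_cast (by linarith : ⟪x, y⟫ + lammin x ≤ 0)
  · refine le_iSup_of_le 0 ?_
    rw [inner_zero_left, zero_add]
    exact_mod_cast h_nonneg 0 h_zero
  · apply EReal.iSup_coe_eq_top_of_forall_exists_le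
    intro M
    by_cases hy : ∀ x ∈ K, 0 ≤ ⟪x, -y⟫
    · have hey : ⟪e, y⟫ + 1 ≠ 0 := fun h0 =>
        h ⟨hy, by rw [inner_neg_right]; linarith⟩
      refine ⟨(M / (⟪e, y⟫ + 1)) • e, ?_⟩
      have hle : M / (⟪e, y⟫ + 1) ≤ lammin ((M / (⟪e, y⟫ + 1)) • e) :=
        (hlammin _).1 (by simpa using h_zero)
      have hM : M / (⟪e, y⟫ + 1) * (⟪e, y⟫ + 1) = M := div_mul_cancel₀ M hey
      rw [real_inner_smul_left]
      linarith
    · push Not at hy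
      obtain ⟨x, hxK, hxy⟩ := hy
      rw [inner_neg_right] at hxy
      have hpos : 0 < ⟪x, y⟫ := by linarith
      refine ⟨(|M| / ⟪x, y⟫) • x, ?_⟩
      have hle := h_nonneg _ (hK_cone (|M| / ⟪x, y⟫) (by positivity) x hxK)
      rw [real_inner_smul_left, div_mul_cancel₀ _ hpos.ne']
      linarith [le_abs_self M]
end

section
/- Let ρ : ℝᵐ → ℝ be a convex differentiable function, A : ℝⁿ → ℝᵐ a linear map, b ∈ ℝᵐ, and C ⊆ ℝⁿ a nonempty set. Fix x ∈ ℝⁿ, set g := Aᵀ∇ρ(Ax − b) and y := −∇ρ(Ax − b), and let z ∈ C be a minimizer of c ↦ ⟨g, c⟩ over C. Then ⟨y, b⟩ − ρ*(−y) − sup_{c∈C} ⟨Aᵀy, c⟩ = ρ(Ax − b) + ⟨Aᵀ∇ρ(Ax − b), z − x⟩, where ρ*(w) = sup_{v∈ℝᵐ}(⟨v, w⟩ − ρ(v)) is the Fenchel conjugate. In particular, the Frank–Wolfe lower bound ρ(Ax − b) + ⟨g, z − x⟩ equals the value of the Fenchel dual objective at the explicit dual point y = −∇ρ(Ax − b).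 -/
open scoped RealInnerProductSpace

/-- First-order characterisation of convexity: a convex function lies above its tangent
hyperplanes. -/
theorem ConvexOn.add_inner_gradient_le {E : Type*} [NormedAddCommGroup E]
    [InnerProductSpace ℝ E] [CompleteSpace E] {f : E → ℝ} (hf : ConvexOn ℝ Set.univ f) {u : E}
    (hd : DifferentiableAt ℝ f u) (v : E) :
    f u + ⟪gradient f u, v - u⟫ ≤ f v := by
  have hconv : ConvexOn ℝ Set.univ (f ∘ AffineMap.lineMap (k := ℝ) u v) := by
    simpa using hf.comp_affineMap (AffineMap.lineMap (k := ℝ) u v)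
  have hderiv : HasDerivAt (f ∘ AffineMap.lineMap (k := ℝ) u v) ⟪gradient f u, v - u⟫ 0 := by
    have h : HasFDerivAt f (InnerProductSpace.toDual ℝ E (gradient f u))
        (AffineMap.lineMap (k := ℝ) u v 0) := by
      simpa using hd.hasGradientAt.hasFDerivAt
    simpa using h.comp_hasDerivAt (0 : ℝ) AffineMap.hasDerivAt_lineMap
  have hslope := hconv.le_slope_of_hasDerivAt (Set.mem_univ 0) (Set.mem_univ 1) one_pos hderiv
  simp only [slope_def_field, Function.comp_apply, AffineMap.lineMap_apply_one,
    AffineMap.lineMap_apply_zero, sub_zero, div_one] at hslope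
  linarith

/-- Fenchel–Young equality: the supremum defining the conjugate at `∇f(u)` is attained at `u`. -/
theorem ConvexOn.isGreatest_conjugate_gradient {E : Type*} [NormedAddCommGroup E]
    [InnerProductSpace ℝ E] [CompleteSpace E] {f : E → ℝ} (hf : ConvexOn ℝ Set.univ f) {u : E}
    (hd : DifferentiableAt ℝ f u) :
    IsGreatest (Set.range fun v => ⟪v, gradient f u⟫ - f v) (⟪u, gradient f u⟫ - f u) := by
  refine ⟨⟨u, rfl⟩, ?_⟩
  rintro _ ⟨v, rfl⟩
  have h := hf.add_inner_gradient_le hd v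
  rw [inner_sub_right, real_inner_comm v, real_inner_comm u] at h
  dsimp only
  linarith

/-- **Frank–Wolfe lower bounds come from explicit dual certificates (§2.3).**
Let `ρ` be convex and differentiable, `A` linear, `C` nonempty. Fix `x`, set
`g = Aᵀ∇ρ(Ax − b)` and `y = −∇ρ(Ax − b)`, and let `z ∈ C` minimize
`c ↦ ⟪g, c⟫` over `C`. Then
`⟪y, b⟫ − ρ*(−y) − sup_{c∈C} ⟪Aᵀy, c⟫ = ρ(Ax − b) + ⟪g, z − x⟫`,
i.e. the Frank–Wolfe lower bound equals the Fenchel dual objective evaluated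
at the dual point `y = −∇ρ(Ax − b)`. -/
theorem frankWolfe_lower_bound_is_dual_value
    (n m : ℕ)
    (ρ : EuclideanSpace ℝ (Fin m) → ℝ) (hρ : ConvexOn ℝ Set.univ ρ)
    (hd : Differentiable ℝ ρ)
    (A : EuclideanSpace ℝ (Fin n) →ₗ[ℝ] EuclideanSpace ℝ (Fin m))
    (b : EuclideanSpace ℝ (Fin m)) (C : Set (EuclideanSpace ℝ (Fin n)))
    (hC : C.Nonempty) (x : EuclideanSpace ℝ (Fin n))
    (g : EuclideanSpace ℝ (Fin n))
    (hg : g = LinearMap.adjoint A (gradient ρ (A x - b)))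
    (y : EuclideanSpace ℝ (Fin m)) (hy : y = -gradient ρ (A x - b))
    (z : EuclideanSpace ℝ (Fin n)) (hzC : z ∈ C)
    (hzmin : ∀ c ∈ C, ⟪g, z⟫ ≤ ⟪g, c⟫)
    (ρstar : EuclideanSpace ℝ (Fin m) → ℝ)
    (hρstar : ∀ w, ρstar w = sSup (Set.range fun v => ⟪v, w⟫ - ρ v)) :
    ⟪y, b⟫ - ρstar (-y) - sSup ((fun c => ⟪LinearMap.adjoint A y, c⟫) '' C) =
      ρ (A x - b) + ⟪g, z - x⟫ := by
  subst hg hy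
  have hsup : IsGreatest
      ((fun c => ⟪LinearMap.adjoint A (-gradient ρ (A x - b)), c⟫) '' C)
      ⟪LinearMap.adjoint A (-gradient ρ (A x - b)), z⟫ := by
    refine ⟨⟨z, hzC, rfl⟩, ?_⟩
    rintro _ ⟨c, hc, rfl⟩
    simpa only [map_neg, inner_neg_left, neg_le_neg_iff] using hzmin c hc
  rw [hsup.csSup_eq, hρstar, neg_neg,
    (hρ.isGreatest_conjugate_gradient (hd (A x - b))).csSup_eq,
    real_inner_comm (gradient ρ (A x - b)) (A x - b)]
  simp only [map_neg, inner_neg_left, inner_sub_right, LinearMap.adjoint_inner_left]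
  ring
end

section
/- Fix α ≥ 2 and let (q_k)_{k≥1} be a real sequence with q₁ ∈ (0,1) satisfying the recurrence q_{k+1} = (1 − α)/(q_k − α). Then q_k ∈ (0,1) for all k, the sequence (q_k) is nondecreasing, and q_k → 1 as k → ∞. (Consequently the inexact secant method with oracle accuracy α ≥ 2 applied to f(τ) = −τ with lower and upper bounds ℓ_k = −2τ_k/(1+α), u_k = −2ατ_k/(1+α) has iterate ratios τ_k/τ_{k-1} tending to one, so the method stalls and fails to converge linearly.) -/
/-- **Stalling of the inexact secant method for α ≥ 2 (§2.1).**
Fix `α ≥ 2` and let `(q k)` satisfy `q 1 ∈ (0,1)` and the recurrence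
`q (k+1) = (1 − α)/(q k − α)` for `k ≥ 1`. Then `q k ∈ (0,1)` for all
`k ≥ 1`, the sequence is nondecreasing, and `q k → 1`; hence the iterate
ratios of the inexact secant method applied to `f(τ) = −τ` with the stated
oracle bounds tend to one and the method stalls. -/
theorem secant_stalls_for_alpha_ge_two
    (α : ℝ) (hα : 2 ≤ α) (q : ℕ → ℝ)
    (hq1 : q 1 ∈ Set.Ioo (0 : ℝ) 1)
    (hrec : ∀ k : ℕ, 1 ≤ k → q (k + 1) = (1 - α) / (q k - α)) :
    (∀ k : ℕ, 1 ≤ k → q k ∈ Set.Ioo (0 : ℝ) 1) ∧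
    (∀ k : ℕ, 1 ≤ k → q k ≤ q (k + 1)) ∧
    Filter.Tendsto q Filter.atTop (nhds 1) := by
  have hmem : ∀ k : ℕ, 1 ≤ k → q k ∈ Set.Ioo (0 : ℝ) 1 := by
    intro k hk
    induction k, hk using Nat.le_induction with
    | base => exact hq1
    | succ k hk ih =>
      obtain ⟨h0, h1⟩ := ih
      have hneg : q k - α < 0 := by linarith
      rw [hrec k hk]
      refine ⟨div_pos_of_neg_of_neg (by linarith) hneg, ?_⟩
      rw [div_lt_one_of_neg hneg]
      linarith
  have hmono : ∀ k : ℕ, 1 ≤ k → q k ≤ q (k + 1) := by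
    intro k hk
    obtain ⟨h0, h1⟩ := hmem k hk
    rw [hrec k hk, le_div_iff_of_neg (by linarith)]
    nlinarith [mul_nonneg (sub_nonneg.2 h1.le) (show 0 ≤ α - 1 - q k by linarith)]
  refine ⟨hmem, hmono, ?_⟩
  have hbdd : BddAbove (Set.range fun n ↦ q (n + 1)) :=
    ⟨1, by rintro _ ⟨n, rfl⟩; exact (hmem (n + 1) (by lia)).2.le⟩
  have hlim := tendsto_atTop_ciSup
    (monotone_nat_of_le_succ fun n ↦ hmono (n + 1) (by lia)) hbdd
  generalize (⨆ n, q (n + 1)) = L at hlim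
  have hL : L ≤ 1 := le_of_tendsto' hlim fun n ↦ (hmem (n + 1) (by lia)).2.le
  have hfix : L = (1 - α) / (L - α) :=
    tendsto_nhds_unique ((Filter.tendsto_add_atTop_iff_nat 1).2 hlim) <|
      (tendsto_const_nhds.div (hlim.sub_const α) (by linarith)).congr
        fun n ↦ (hrec (n + 1) (by lia)).symm
  rw [eq_div_iff (by linarith)] at hfix
  have hL1 : L = 1 := by nlinarith
  exact (Filter.tendsto_add_atTop_iff_nat 1).1 (hL1 ▸ hlim)
end
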